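/- For every n ≥ 2, the space of functions on Young diagrams obtained by restricting homogeneous degree-n elements of Sol to lists of interlacing coordinates (i.e. the image of the degree-n component of Sol under the evaluation map ActY) is a ℂ-vector space of dimension 2^{n−2}. -/

import Mathlib

open MvPolynomial

/-- Sequences of polynomials: the `n`-th term is thought of as a polynomial in
`x_1, …, x_n` (variable `j : ℕ` corresponds to `x_{j+1}`). -/
abbrev PolySeq : Type := (n : ℕ) → MvPolynomial ℕ ℂ

/-- The algebra morphism substituting `0` for the variable `x_{n+1}` (index `n`). -/
noncomputable def killVar (n : ℕ) : MvPolynomial ℕ ℂ →ₐ[ℂ] MvPolynomial ℕ ℂ :=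
  aeval (fun j => if j = n then 0 else X j)

/-- `f` is a *stable polynomial*: `f n` only involves `x_1, …, x_n` and setting the last
variable of `f (n+1)` to zero gives back `f n`. -/
def IsStable (f : PolySeq) : Prop :=
  (∀ n, f n ∈ supported ℂ (Set.Iio n)) ∧ ∀ n, killVar n (f (n + 1)) = f n

/-- The substitution `x_{j+2} := x_{j+1}` (0-based : variable `j+1` is replaced by variable `j`). -/
noncomputable def collapse (j : ℕ) : MvPolynomial ℕ ℂ →ₐ[ℂ] MvPolynomial ℕ ℂ :=
  aeval (fun k => if k = j + 1 then X j else X k)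

/-- Renaming of variables skipping the two indices `j`, `j+1`. -/
noncomputable def skip2 (j : ℕ) : MvPolynomial ℕ ℂ →ₐ[ℂ] MvPolynomial ℕ ℂ :=
  rename (fun k => if k < j then k else k + 2)

/-- The functional equation (1) of the paper: substituting `x_{i+1} = x_i` in `f_n` yields
`f_{n-2} (x_1, …, x_{i-1}, x_{i+2}, …, x_n)`. -/
def IsSol (f : PolySeq) : Prop :=
  IsStable f ∧ ∀ n j : ℕ, j + 2 ≤ n → collapse j (f n) = skip2 j (f (n - 2))

/-- Homogeneity of degree `d` for a stable polynomial. -/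
def IsHomogSeq (f : PolySeq) (d : ℕ) : Prop := ∀ n, (f n).IsHomogeneous d

private lemma homog_smul {p : MvPolynomial ℕ ℂ} {d : ℕ} (c : ℂ) (h : p.IsHomogeneous d) :
    (c • p).IsHomogeneous d := by
  rw [smul_eq_C_mul]
  simpa using (isHomogeneous_C ℕ c).mul h

/-- The homogeneous component of degree `d` of the space of solutions of the
functional equation, as a `ℂ`-vector space. -/
noncomputable def SolHomog (d : ℕ) : Submodule ℂ PolySeq where
  carrier := {f | IsSol f ∧ IsHomogSeq f d}
  zero_mem' := by
    refine ⟨⟨⟨fun n => Subalgebra.zero_mem _, fun n => by simp only [Pi.zero_apply, map_zero]⟩,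
      fun n j _ => by simp only [Pi.zero_apply, map_zero]⟩, fun n => isHomogeneous_zero _ _ _⟩
  add_mem' := by
    rintro a b ⟨⟨⟨ha1, ha2⟩, ha3⟩, ha4⟩ ⟨⟨⟨hb1, hb2⟩, hb3⟩, hb4⟩
    refine ⟨⟨⟨fun n => Subalgebra.add_mem _ (ha1 n) (hb1 n), fun n => ?_⟩, fun n j h => ?_⟩,
      fun n => (ha4 n).add (hb4 n)⟩
    · simp only [Pi.add_apply, map_add, ha2 n, hb2 n]
    · simp only [Pi.add_apply, map_add, ha3 n j h, hb3 n j h]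
  smul_mem' := by
    rintro c a ⟨⟨⟨ha1, ha2⟩, ha3⟩, ha4⟩
    refine ⟨⟨⟨fun n => Subalgebra.smul_mem _ (ha1 n) c, fun n => ?_⟩, fun n j h => ?_⟩,
      fun n => homog_smul c (ha4 n)⟩
    · simp only [Pi.smul_apply, map_smul, ha2 n]
    · simp only [Pi.smul_apply, map_smul, ha3 n j h]

/-- The lists of interlacing (Kerov) coordinates of Young diagrams: strictly decreasing integer
sequences `x_1 > … > x_{2m+1}` (recorded as a function `ℕ → ℤ` together with `m`; 0-based
indices) whose alternating sum `∑_{i=1}^{2m+1} (-1)^i x_i` vanishes. -/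
def Interlacing : Type :=
  {xm : (ℕ → ℤ) × ℕ // (∀ i, i + 1 ≤ 2 * xm.2 → xm.1 (i + 1) < xm.1 i) ∧
    (∑ j ∈ Finset.range (2 * xm.2 + 1), (-1 : ℤ) ^ j * xm.1 j) = 0}

/-- The evaluation map sending a stable polynomial to the function it defines on lists of
interlacing coordinates (i.e. on Young diagrams). -/
noncomputable def ActY : PolySeq →ₗ[ℂ] (Interlacing → ℂ) where
  toFun f := fun x => aeval (fun j => ((x.1.1 j : ℤ) : ℂ)) (f (2 * x.1.2 + 1))
  map_add' f g := by funext x; exact map_add (aeval _) _ _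
  map_smul' c f := by funext x; exact map_smul (aeval (R := ℂ) _) c _


/-! ### Coefficients of the substitutions -/

lemma collapse_eq_rename (j : ℕ) :
    collapse j = rename (fun k => if k = j + 1 then j else k) := by
  ext k : 1
  simp only [collapse, aeval_X, rename_X]
  split_ifs <;> rfl

lemma exists_eq_add_single_add_single (s : ℕ →₀ ℕ) (j : ℕ) :
    ∃ (t : ℕ →₀ ℕ) (p q : ℕ), t j = 0 ∧ t (j + 1) = 0 ∧
      s = t + Finsupp.single j p + Finsupp.single (j + 1) q := by
  refine ⟨(s.erase j).erase (j + 1), s j, s (j + 1), by simp, by simp, ?_⟩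
  ext k
  by_cases h1 : k = j
  · subst h1; simp
  by_cases h2 : k = j + 1
  · subst h2; simp
  simp [h1, h2]

lemma mapDomain_collapse {j : ℕ} {t : ℕ →₀ ℕ} (ht : t (j + 1) = 0) (p q : ℕ) :
    Finsupp.mapDomain (fun k => if k = j + 1 then j else k)
      (t + Finsupp.single j p + Finsupp.single (j + 1) q) = t + Finsupp.single j (p + q) := by
  have h : Finsupp.mapDomain (fun k => if k = j + 1 then j else k) t = t := by
    conv_rhs => rw [← Finsupp.mapDomain_id (v := t)]
    refine Finsupp.mapDomain_congr fun k hk => if_neg ?_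
    rintro rfl
    exact (Finsupp.mem_support_iff.1 hk) ht
  simp [Finsupp.mapDomain_add, Finsupp.mapDomain_single, h, add_assoc]

lemma coeff_collapse {j : ℕ} (r : ℕ) {e : ℕ →₀ ℕ} (hj : e j = 0) (hj' : e (j + 1) = 0)
    (P : MvPolynomial ℕ ℂ) :
    coeff (e + Finsupp.single j r) (collapse j P) =
      ∑ pq ∈ Finset.HasAntidiagonal.antidiagonal r,
        coeff (e + Finsupp.single j pq.1 + Finsupp.single (j + 1) pq.2) P := by
  induction P using MvPolynomial.induction_on' with
  | monomial s a =>
    obtain ⟨t, p, q, ht, ht', rfl⟩ := exists_eq_add_single_add_single s j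
    rw [collapse_eq_rename, rename_monomial, mapDomain_collapse ht', coeff_monomial]
    have key : ∀ pq : ℕ × ℕ, (t + Finsupp.single j p + Finsupp.single (j + 1) q =
        e + Finsupp.single j pq.1 + Finsupp.single (j + 1) pq.2) ↔ (t = e ∧ (p, q) = pq) := by
      rintro ⟨p', q'⟩
      refine ⟨fun h => ?_, fun ⟨h1, h2⟩ => by cases h2; rw [h1]⟩
      have h1 := DFunLike.congr_fun h j
      have h2 := DFunLike.congr_fun h (j + 1)
      simp [ht, ht', hj, hj'] at h1 h2
      subst h1 h2
      simpa using h
    have key' : (t + Finsupp.single j (p + q) = e + Finsupp.single j r) ↔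
        (t = e ∧ p + q = r) := by
      refine ⟨fun h => ?_, fun ⟨h1, h2⟩ => by rw [h1, h2]⟩
      have h1 := DFunLike.congr_fun h j
      simp [ht, hj] at h1
      subst h1
      simpa using h
    simp only [coeff_monomial, key, key']
    by_cases h : t = e <;> simp [h]
  | add P Q hP hQ => simp only [map_add, coeff_add, hP, hQ, Finset.sum_add_distrib]

lemma coeff_killVar {n : ℕ} {e : ℕ →₀ ℕ} (he : e n = 0) (P : MvPolynomial ℕ ℂ) :
    coeff e (killVar n P) = coeff e P := by
  induction P using MvPolynomial.induction_on' with
  | monomial s a =>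
    by_cases hs : s n = 0
    · congr 1
      rw [killVar, aeval_monomial, monomial_eq]
      congr 1
      refine Finsupp.prod_congr fun k hk => ?_
      rw [if_neg]
      rintro rfl
      exact (Finsupp.mem_support_iff.1 hk) hs
    · have h1 : killVar n (monomial s a) = 0 := by
        rw [killVar, aeval_monomial, Finsupp.prod,
          Finset.prod_eq_zero (Finsupp.mem_support_iff.2 hs) (by simp [hs]), mul_zero]
      have h2 : s ≠ e := by rintro rfl; exact hs he
      rw [h1, coeff_monomial, if_neg h2, coeff_zero]
  | add P Q hP hQ => simp only [map_add, coeff_add, hP, hQ]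

lemma coeff_eq_zero_of_mem_supported {S : Set ℕ} {P : MvPolynomial ℕ ℂ}
    (hP : P ∈ supported ℂ S) {e : ℕ →₀ ℕ} {k : ℕ} (hk : k ∉ S) (he : e k ≠ 0) :
    coeff e P = 0 := by
  by_contra h
  exact hk (mem_supported.1 hP ((mem_vars_iff_mem_support k).2 ⟨e, mem_support_iff.2 h,
    Finsupp.mem_support_iff.2 he⟩))

/-! ### Exponents given by lists -/

/-- The exponent whose values at `s, s + 1, …` are the entries of the list. -/
noncomputable def expo : ℕ → List ℕ → (ℕ →₀ ℕ)
  | _, [] => 0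
  | s, a :: l => Finsupp.single s a + expo (s + 1) l

lemma expo_apply_of_lt {s k : ℕ} (l : List ℕ) (h : k < s) : expo s l k = 0 := by
  induction l generalizing s with
  | nil => rfl
  | cons a l ih => simp [expo, ih (Nat.lt_succ_of_lt h), h.ne']

lemma expo_apply_of_length_le {s k : ℕ} (l : List ℕ) (h : s + l.length ≤ k) :
    expo s l k = 0 := by
  induction l generalizing s with
  | nil => rfl
  | cons a l ih =>
    rw [List.length_cons] at h
    have : s ≠ k := by omega
    simp [expo, ih (s := s + 1) (by omega), this]

lemma expo_append (s : ℕ) (u v : List ℕ) :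
    expo s (u ++ v) = expo s u + expo (s + u.length) v := by
  induction u generalizing s with
  | nil => simp [expo]
  | cons a u ih =>
    simp [expo, ih, add_assoc, add_comm 1]

lemma expo_map_range' (n s : ℕ) (e : ℕ → ℕ) (k : ℕ) :
    expo s ((List.range' s n).map e) k = if s ≤ k ∧ k < s + n then e k else 0 := by
  induction n generalizing s with
  | zero => simp [expo]
  | succ n ih =>
    simp only [List.range'_succ, List.map_cons, expo, Finsupp.add_apply, ih,
      Finsupp.single_apply]
    grind

lemma mapDomain_skip_expo (j s : ℕ) (l : List ℕ) (h : j ≤ s) :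
    Finsupp.mapDomain (fun k => if k < j then k else k + 2) (expo s l) = expo (s + 2) l := by
  induction l generalizing s with
  | nil => simp [expo]
  | cons a l ih =>
    simp only [expo, Finsupp.mapDomain_add, Finsupp.mapDomain_single, ih (s + 1) (by omega),
      if_neg (not_lt.2 h)]

lemma mapDomain_skip_expo_append (u v : List ℕ) :
    Finsupp.mapDomain (fun k => if k < u.length then k else k + 2) (expo 0 (u ++ v)) =
      expo 0 (u ++ 0 :: 0 :: v) := by
  have h : Finsupp.mapDomain (fun k => if k < u.length then k else k + 2) (expo 0 u) =
      expo 0 u := by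
    conv_rhs => rw [← Finsupp.mapDomain_id (v := expo 0 u)]
    refine Finsupp.mapDomain_congr fun k hk => if_pos ?_
    by_contra hk'
    exact Finsupp.mem_support_iff.1 hk (expo_apply_of_length_le u (by omega))
  simp only [expo_append, Finsupp.mapDomain_add, h, expo, Finsupp.single_zero, zero_add,
    mapDomain_skip_expo _ _ _ le_rfl]

lemma skip_injective (j : ℕ) : Function.Injective fun k => if k < j then k else k + 2 := by
  intro a b h
  dsimp only at h
  split_ifs at h <;> omega

/-! ### Coefficients of solutions -/

/-- The coefficient of `x_1 ^ l_1 ⋯ x_n ^ l_n` in `f_n`. -/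
noncomputable def listCoeff (f : PolySeq) (l : List ℕ) : ℂ := coeff (expo 0 l) (f l.length)

lemma listCoeff_append_zero {f : PolySeq} (hf : IsStable f) (l : List ℕ) :
    listCoeff f (l ++ [0]) = listCoeff f l := by
  simp only [listCoeff, expo_append, expo, Finsupp.single_zero, add_zero, List.length_append,
    List.length_singleton]
  rw [← hf.2 l.length, coeff_killVar (expo_apply_of_length_le _ (by simp))]

lemma coeff_collapse_expo (u v : List ℕ) (r : ℕ) (P : MvPolynomial ℕ ℂ) :
    coeff (expo 0 (u ++ r :: 0 :: v)) (collapse u.length P) =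
      ∑ pq ∈ Finset.HasAntidiagonal.antidiagonal r,
        coeff (expo 0 (u ++ pq.1 :: pq.2 :: v)) P := by
  have h (p q : ℕ) : expo 0 (u ++ p :: q :: v) = (expo 0 u + expo (u.length + 1 + 1) v) +
      Finsupp.single u.length p + Finsupp.single (u.length + 1) q := by
    simp only [expo_append, expo, zero_add]
    abel
  simp only [h]
  rw [Finsupp.single_zero, add_zero, coeff_collapse]
  · rw [Finsupp.add_apply, expo_apply_of_length_le _ (by simp), expo_apply_of_lt _ (by omega)]
  · rw [Finsupp.add_apply, expo_apply_of_length_le _ (by simp), expo_apply_of_lt _ (by omega)]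

lemma listCoeff_insert_zero_zero {f : PolySeq} (hf : IsSol f) (u v : List ℕ) :
    listCoeff f (u ++ 0 :: 0 :: v) = listCoeff f (u ++ v) := by
  have h := congrArg (coeff (expo 0 (u ++ 0 :: 0 :: v)))
    (hf.2 (u ++ 0 :: 0 :: v).length u.length (by simp))
  rw [coeff_collapse_expo, ← mapDomain_skip_expo_append, skip2,
    coeff_rename_mapDomain _ (skip_injective _)] at h
  simpa [listCoeff, ← add_assoc] using h

lemma sum_listCoeff_eq_zero {f : PolySeq} (hf : IsSol f) (u v : List ℕ) {r : ℕ} (hr : r ≠ 0) :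
    ∑ pq ∈ Finset.HasAntidiagonal.antidiagonal r, listCoeff f (u ++ pq.1 :: pq.2 :: v) = 0 := by
  have h := congrArg (coeff (expo 0 (u ++ r :: 0 :: v)))
    (hf.2 (u ++ r :: 0 :: v).length u.length (by simp))
  rw [coeff_collapse_expo, skip2, coeff_rename_eq_zero] at h
  · simpa [listCoeff] using h
  · intro w hw
    exfalso
    apply hr
    have h2 : expo 0 (u ++ r :: 0 :: v) u.length = r := by
      rw [expo_append, Finsupp.add_apply, expo_apply_of_length_le _ (by simp), expo,
        Finsupp.add_apply, expo_apply_of_lt _ (by omega)]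
      simp
    rw [← h2, ← hw]
    apply Finsupp.mapDomain_of_notMem_range
    rintro ⟨k, hk⟩
    dsimp only at hk
    split_ifs at hk <;> omega

/-! ### A solution is determined by the coefficients of `x_1 ^ j_1 x_3 ^ j_2 x_5 ^ j_3 ⋯` -/

/-- Insert a zero after every entry of a list. -/
def spread : List ℕ → List ℕ
  | [] => []
  | j :: J => j :: 0 :: spread J

lemma spread_append (J K : List ℕ) : spread (J ++ K) = spread J ++ spread K := by
  induction J with
  | nil => rfl
  | cons j J ih => simp [spread, ih]

lemma length_spread (J : List ℕ) : (spread J).length = 2 * J.length := by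
  induction J with
  | nil => rfl
  | cons j J ih => simp only [spread, List.length_cons, ih]; ring

lemma sum_spread (J : List ℕ) : (spread J).sum = J.sum := by
  induction J with
  | nil => rfl
  | cons j J ih => simp [spread, ih]

lemma degree_expo (s : ℕ) (l : List ℕ) : (expo s l).degree = l.sum := by
  induction l generalizing s with
  | nil => simp [expo]
  | cons a l ih => simp [expo, ih]

lemma listCoeff_eq_zero_of_sum_ne {f : PolySeq} {d : ℕ} (hf : IsHomogSeq f d) {l : List ℕ}
    (hl : l.sum ≠ d) : listCoeff f l = 0 :=
  (hf l.length).coeff_eq_zero (by rwa [degree_expo])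

lemma listCoeff_swap {f : PolySeq} (hf : IsSol f) (u v : List ℕ) {r : ℕ} (hr : r ≠ 0)
    (h : ∀ p q, p ≠ 0 → q ≠ 0 → listCoeff f (u ++ p :: q :: v) = 0) :
    listCoeff f (u ++ 0 :: r :: v) = -listCoeff f (u ++ r :: 0 :: v) := by
  have h1 := sum_listCoeff_eq_zero hf u v hr
  rw [Finset.sum_eq_add_of_mem (0, r) (r, 0) (by simp) (by simp) (by simp [hr.symm])] at h1
  · exact eq_neg_of_add_eq_zero_left h1
  · rintro ⟨p, q⟩ hpq ⟨h2, h3⟩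
    rw [Finset.HasAntidiagonal.mem_antidiagonal] at hpq
    dsimp only at hpq
    refine h p q ?_ ?_
    · rintro rfl; simp_all
    · rintro rfl; simp_all

lemma listCoeff_spread_append_eq_zero_of_step {f : PolySeq} (hf : IsSol f)
    (h0 : ∀ J : List ℕ, (∀ j ∈ J, j ≠ 0) → listCoeff f (spread J) = 0) (k : ℕ)
    (hk : ∀ J v : List ℕ, (∀ j ∈ J, j ≠ 0) → k < J.length + v.countP (· ≠ 0) →
      listCoeff f (spread J ++ v) = 0) :
    ∀ v J : List ℕ, (∀ j ∈ J, j ≠ 0) → k ≤ J.length + v.countP (· ≠ 0) →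
      listCoeff f (spread J ++ v) = 0 := by
  have snoc {J : List ℕ} {r : ℕ} (hJ : ∀ j ∈ J, j ≠ 0) (hr : r ≠ 0) : ∀ j ∈ J ++ [r], j ≠ 0 := by
    simpa [or_imp, forall_and] using ⟨hJ, hr⟩
  have absorb (J v : List ℕ) (r : ℕ) : spread J ++ r :: 0 :: v = spread (J ++ [r]) ++ v := by
    simp [spread_append, spread]
  have swap {J v : List ℕ} {r : ℕ} (hJ : ∀ j ∈ J, j ≠ 0) (hr : r ≠ 0)
      (h : k ≤ J.length + v.countP (· ≠ 0) + 1) :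
      listCoeff f (spread J ++ 0 :: r :: v) = -listCoeff f (spread (J ++ [r]) ++ v) := by
    rw [← absorb]
    refine listCoeff_swap hf _ _ hr fun p q hp hq => hk _ _ hJ ?_
    simp [hp, hq]
    simp at h
    omega
  intro v
  induction hn : v.length using Nat.strong_induction_on generalizing v with
  | _ n ih =>
  intro J hJ hc
  match v, hn, hc with
  | [], _, _ => simpa using h0 J hJ
  | [0], _, _ => rw [listCoeff_append_zero hf.1]; exact h0 J hJ
  | [r + 1], _, _ =>
    rw [← listCoeff_append_zero hf.1, List.append_assoc, List.singleton_append, absorb]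
    simpa using h0 _ (snoc hJ r.succ_ne_zero)
  | 0 :: 0 :: v, hn, hc =>
    rw [listCoeff_insert_zero_zero hf]
    exact ih _ (by simp [← hn]) v rfl J hJ (by simpa using hc)
  | 0 :: (r + 1) :: v, hn, hc =>
    rw [swap hJ r.succ_ne_zero (by simp at hc ⊢; omega),
      ih _ (by simp [← hn]) v rfl _ (snoc hJ r.succ_ne_zero) (by simp at hc ⊢; omega), neg_zero]
  | (r + 1) :: 0 :: v, hn, hc =>
    rw [absorb]
    exact ih _ (by simp [← hn]) v rfl _ (snoc hJ r.succ_ne_zero) (by simp at hc ⊢; omega)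
  | (r + 1) :: (q + 1) :: v, hn, hc =>
    have h1 := listCoeff_insert_zero_zero hf (spread J ++ [r + 1]) ((q + 1) :: v)
    have h2 := snoc hJ r.succ_ne_zero
    simp only [List.append_assoc, List.singleton_append, absorb] at h1
    rw [← h1, swap h2 q.succ_ne_zero (by simp at hc ⊢; omega),
      ih _ (by simp [← hn]) v rfl _ (snoc h2 q.succ_ne_zero) (by simp at hc ⊢; omega), neg_zero]

lemma countP_ne_zero_le_sum (l : List ℕ) : l.countP (· ≠ 0) ≤ l.sum := by
  induction l with
  | nil => simp
  | cons a l ih => rcases a with _ | a <;> simp at ih ⊢ <;> omega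

lemma length_le_sum_of_ne_zero {J : List ℕ} (hJ : ∀ j ∈ J, j ≠ 0) : J.length ≤ J.sum := by
  have h : J.countP (· ≠ 0) = J.length := List.countP_eq_length.2 (by simpa using hJ)
  exact h ▸ countP_ne_zero_le_sum J

lemma eq_zero_of_listCoeff_spread_eq_zero {f : PolySeq} {d : ℕ} (hf : f ∈ SolHomog d)
    (h0 : ∀ J : List ℕ, (∀ j ∈ J, j ≠ 0) → J.sum = d → listCoeff f (spread J) = 0) : f = 0 := by
  obtain ⟨hsol, hhom⟩ := hf
  have h0' (J : List ℕ) (hJ : ∀ j ∈ J, j ≠ 0) : listCoeff f (spread J) = 0 := by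
    by_cases h : J.sum = d
    · exact h0 J hJ h
    · exact listCoeff_eq_zero_of_sum_ne hhom (by rwa [sum_spread])
  have main : ∀ m : ℕ, ∀ J v : List ℕ, (∀ j ∈ J, j ≠ 0) →
      d + 1 - m ≤ J.length + v.countP (· ≠ 0) → listCoeff f (spread J ++ v) = 0 := by
    intro m
    induction m with
    | zero =>
      intro J v hJ h
      refine listCoeff_eq_zero_of_sum_ne hhom ?_
      have h1 := countP_ne_zero_le_sum v
      have h2 := length_le_sum_of_ne_zero hJ
      rw [List.sum_append, sum_spread]
      omega
    | succ m ih =>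
      intro J v
      exact listCoeff_spread_append_eq_zero_of_step hsol h0' (d + 1 - (m + 1))
        (fun J v hJ h => ih J v hJ (by omega)) v J
  funext n
  ext e
  rw [Pi.zero_apply, coeff_zero]
  by_cases he : ∀ k, n ≤ k → e k = 0
  · have h1 : e = expo 0 ((List.range' 0 n).map e) := by
      ext k
      rw [expo_map_range']
      by_cases hk : k < n
      · simp [hk]
      · simp [hk, he k (not_lt.1 hk)]
    have h2 := main (d + 1) [] ((List.range' 0 n).map e) (by simp) (by simp)
    simpa [listCoeff, spread, ← h1] using h2
  · push Not at he
    obtain ⟨k, hk, hk'⟩ := he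
    exact coeff_eq_zero_of_mem_supported (hsol.1.1 n) (by simpa using hk) hk'

/-! ### A basis of solutions

The polynomials below are the coefficients of the words `S_{i_1} ⋯ S_{i_k}` in the product
`σ(x_1) σ(x_2)⁻¹ σ(x_3) ⋯`, where `σ(x) = 1 + ∑_{i ≥ 1} S_i x ^ i` in noncommuting `S_i`. -/

section Construction

variable {R S : Type*} [CommRing R] [CommRing S]

/-- The `i`-th power for `i ≥ 1`, and `0` for `i = 0`. -/
def posPow (x : R) (i : ℕ) : R := if i = 0 then 0 else x ^ i

/-- The coefficients of `σ(x) F`, where `F` is the family of coefficients of a noncommutative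
power series. -/
def mulSigma (x : R) (F : List ℕ → R) : List ℕ → R
  | [] => F []
  | i :: I => F (i :: I) + posPow x i * F I

/-- The coefficients of `σ(x)⁻¹ F`. -/
def mulSigmaInv (x : R) (F : List ℕ → R) : List ℕ → R
  | [] => F []
  | i :: I => F (i :: I) - posPow x i * mulSigmaInv x F I

lemma mulSigma_mulSigmaInv (x : R) (F : List ℕ → R) : mulSigma x (mulSigmaInv x F) = F := by
  funext I
  cases I <;> simp [mulSigma, mulSigmaInv]

lemma mulSigmaInv_mulSigma (x : R) (F : List ℕ → R) : mulSigmaInv x (mulSigma x F) = F := by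
  funext I
  induction I <;> simp_all [mulSigma, mulSigmaInv]

lemma mulSigma_zero (F : List ℕ → R) : mulSigma 0 F = F := by
  funext I
  rcases I with _ | ⟨_ | i, I⟩ <;> simp [mulSigma, posPow]

lemma mulSigmaInv_zero (F : List ℕ → R) : mulSigmaInv 0 F = F := by
  rw [← mulSigma_zero (mulSigmaInv 0 F), mulSigma_mulSigmaInv]

/-- The coefficients of `σ(x_1) σ(x_2)⁻¹ σ(x_3) ⋯`, or of `σ(x_1)⁻¹ σ(x_2) σ(x_3)⁻¹ ⋯` if the
Boolean is `false`. -/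
def sigmaProd : Bool → List R → List ℕ → R
  | _, [] => fun I => if I = [] then 1 else 0
  | true, x :: xs => mulSigma x (sigmaProd false xs)
  | false, x :: xs => mulSigmaInv x (sigmaProd true xs)

lemma sigmaProd_append_zero (b : Bool) (xs : List R) :
    sigmaProd b (xs ++ [0]) = sigmaProd b xs := by
  induction xs generalizing b with
  | nil => cases b <;> simp [sigmaProd, mulSigma_zero, mulSigmaInv_zero]
  | cons x xs ih => cases b <;> simp [sigmaProd, ih]

lemma sigmaProd_append_pair (b : Bool) (xs ys : List R) (a : R) :
    sigmaProd b (xs ++ a :: a :: ys) = sigmaProd b (xs ++ ys) := by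
  induction xs generalizing b with
  | nil => cases b <;> simp [sigmaProd, mulSigma_mulSigmaInv, mulSigmaInv_mulSigma]
  | cons x xs ih => cases b <;> simp [sigmaProd, ih]

lemma map_posPow (φ : R →+* S) (x : R) (i : ℕ) : φ (posPow x i) = posPow (φ x) i := by
  unfold posPow
  split_ifs <;> simp

lemma map_mulSigma (φ : R →+* S) (x : R) (F : List ℕ → R) (I : List ℕ) :
    φ (mulSigma x F I) = mulSigma (φ x) (fun J => φ (F J)) I := by
  cases I <;> simp [mulSigma, map_posPow]

lemma map_mulSigmaInv (φ : R →+* S) (x : R) (F : List ℕ → R) (I : List ℕ) :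
    φ (mulSigmaInv x F I) = mulSigmaInv (φ x) (fun J => φ (F J)) I := by
  induction I <;> simp_all [mulSigmaInv, map_posPow]

lemma map_sigmaProd (φ : R →+* S) (b : Bool) (xs : List R) (I : List ℕ) :
    φ (sigmaProd b xs I) = sigmaProd b (xs.map φ) I := by
  induction xs generalizing b I with
  | nil => simp [sigmaProd, apply_ite φ]
  | cons x xs ih => cases b <;> simp [sigmaProd, map_mulSigma, map_mulSigmaInv, ih]

lemma sigmaProd_mem {A : Type*} [CommRing A] [Algebra A R] (T : Subalgebra A R) (b : Bool)
    {xs : List R} (hxs : ∀ x ∈ xs, x ∈ T) (I : List ℕ) : sigmaProd b xs I ∈ T := by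
  have hp {x : R} (hx : x ∈ T) (i : ℕ) : posPow x i ∈ T := by
    unfold posPow
    split_ifs
    exacts [T.zero_mem, T.pow_mem hx i]
  induction xs generalizing b I with
  | nil =>
    dsimp only [sigmaProd]
    split_ifs
    exacts [T.one_mem, T.zero_mem]
  | cons x xs ih =>
    rw [List.forall_mem_cons] at hxs
    cases b
    · rw [sigmaProd]
      induction I with
      | nil => exact ih _ hxs.2 _
      | cons i I ihI =>
        rw [mulSigmaInv]
        exact T.sub_mem (ih _ hxs.2 _) (T.mul_mem (hp hxs.1 i) ihI)
    · rw [sigmaProd]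
      cases I with
      | nil => exact ih _ hxs.2 _
      | cons i I =>
        rw [mulSigma]
        exact T.add_mem (ih _ hxs.2 _) (T.mul_mem (hp hxs.1 i) (ih _ hxs.2 _))

end Construction

lemma sigmaProd_isHomogeneous (b : Bool) {xs : List (MvPolynomial ℕ ℂ)}
    (hxs : ∀ x ∈ xs, x.IsHomogeneous 1) (I : List ℕ) :
    (sigmaProd b xs I).IsHomogeneous I.sum := by
  have hp {x : MvPolynomial ℕ ℂ} (hx : x.IsHomogeneous 1) (i : ℕ) :
      (posPow x i).IsHomogeneous i := by
    unfold posPow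
    split_ifs
    · exact isHomogeneous_zero _ _ _
    · simpa using hx.pow i
  induction xs generalizing b I with
  | nil =>
    dsimp only [sigmaProd]
    split_ifs with h
    · subst h; exact isHomogeneous_one _ _
    · exact isHomogeneous_zero _ _ _
  | cons x xs ih =>
    rw [List.forall_mem_cons] at hxs
    cases b
    · rw [sigmaProd]
      induction I with
      | nil => exact ih _ hxs.2 _
      | cons i I ihI =>
        rw [mulSigmaInv]
        exact (ih _ hxs.2 _).sub ((hp hxs.1 i).mul ihI)
    · rw [sigmaProd]
      cases I with
      | nil => exact ih _ hxs.2 _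
      | cons i I =>
        rw [mulSigma]
        exact (ih _ hxs.2 _).add ((hp hxs.1 i).mul (ih _ hxs.2 _))

/-- The solution attached to a list of integers. -/
noncomputable def basisSol (I : List ℕ) : PolySeq :=
  fun n => sigmaProd true ((List.range' 0 n).map X) I

lemma range'_succ_eq_append (s n : ℕ) : List.range' s (n + 1) = List.range' s n ++ [s + n] := by
  simpa using List.range'_concat (s := s) (n := n) (step := 1)

lemma killVar_X_of_ne {n k : ℕ} (h : k ≠ n) : killVar n (X k) = X k := by
  rw [killVar, aeval_X, if_neg h]

lemma killVar_X_self (n : ℕ) : killVar n (X n) = 0 := by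
  rw [killVar, aeval_X, if_pos rfl]

lemma basisSol_mem (I : List ℕ) : basisSol I ∈ SolHomog I.sum := by
  refine ⟨⟨⟨fun n => ?_, fun n => ?_⟩, fun n j hj => ?_⟩, fun n => ?_⟩
  · refine sigmaProd_mem _ _ (fun x hx => ?_) I
    obtain ⟨k, hk, rfl⟩ := List.mem_map.1 hx
    exact X_mem_supported.2 (by simpa using hk)
  · have h : (List.range' 0 n).map (fun k => killVar n (X k)) = (List.range' 0 n).map X := by
      refine List.map_congr_left fun k hk => killVar_X_of_ne ?_
      simp at hk
      omega
    refine (map_sigmaProd (killVar n : MvPolynomial ℕ ℂ →+* MvPolynomial ℕ ℂ) _ _ _).trans ?_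
    simp [range'_succ_eq_append, Function.comp_def, h, killVar_X_self, sigmaProd_append_zero,
      basisSol]
  · obtain ⟨m, rfl⟩ := Nat.exists_eq_add_of_le hj
    refine ((map_sigmaProd (collapse j : MvPolynomial ℕ ℂ →+* MvPolynomial ℕ ℂ) _ _ _).trans
      ?_).trans (map_sigmaProd (skip2 j : MvPolynomial ℕ ℂ →+* MvPolynomial ℕ ℂ) _ _ _).symm
    have h1 : List.range' 0 (j + 2 + m) = List.range' 0 j ++ j :: (j + 1) :: List.range' (j + 2) m := by
      rw [add_assoc, ← List.range'_append_1, add_comm 2 m, List.range'_succ, List.range'_succ]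
      simp
    have h2 : List.range' 0 (j + 2 + m - 2) = List.range' 0 j ++ List.range' j m := by
      rw [show j + 2 + m - 2 = j + m by omega, ← List.range'_append_1, zero_add]
    simp only [h1, h2, List.map_append, List.map_cons, List.map_map, Function.comp_def,
      RingHom.coe_coe]
    have h3 : (List.range' 0 j).map (fun k => collapse j (X k)) =
        (List.range' 0 j).map fun k => skip2 j (X k) := by
      refine List.map_congr_left fun k hk => ?_
      have : k < j := by simpa using hk
      simp only [collapse, skip2, aeval_X, rename_X, if_pos this]
      rw [if_neg (by omega)]
    have h4 : (List.range' (j + 2) m).map (fun k => collapse j (X k)) =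
        (List.range' j m).map fun k => skip2 j (X k) := by
      rw [add_comm j 2, ← List.map_add_range', List.map_map]
      refine List.map_congr_left fun k hk => ?_
      have : ¬ k < j := by simp at hk; omega
      simp only [collapse, skip2, aeval_X, rename_X, if_neg this, Function.comp_apply]
      rw [if_neg (by omega), add_comm]
    have h5 : collapse j (X j) = X j := by simp [collapse]
    have h6 : collapse j (X (j + 1)) = X j := by simp [collapse]
    rw [h3, h4, h5, h6, sigmaProd_append_pair]
  · refine sigmaProd_isHomogeneous _ (fun x hx => ?_) I
    obtain ⟨k, hk, rfl⟩ := List.mem_map.1 hx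
    exact isHomogeneous_X _ _

lemma coeff_posPow_X_mul {s i : ℕ} {e : ℕ →₀ ℕ} (he : e s = 0) (P : MvPolynomial ℕ ℂ) :
    coeff e (posPow (X s) i * P) = 0 := by
  unfold posPow
  split_ifs with h
  · simp
  · rw [X_pow_eq_monomial, coeff_monomial_mul', if_neg]
    intro h'
    have := h' s
    simp [he] at this
    exact h this

lemma coeff_mulSigmaInv_X {s : ℕ} {e : ℕ →₀ ℕ} (he : e s = 0)
    (F : List ℕ → MvPolynomial ℕ ℂ) (I : List ℕ) :
    coeff e (mulSigmaInv (X s) F I) = coeff e (F I) := by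
  cases I <;> simp [mulSigmaInv, coeff_posPow_X_mul he]

lemma coeff_mulSigma_X {s j : ℕ} {e : ℕ →₀ ℕ} (he : e s = 0) (hj : j ≠ 0)
    {F : List ℕ → MvPolynomial ℕ ℂ} (hF : ∀ I, F I ∈ supported ℂ {s}ᶜ) (i : ℕ) (I : List ℕ) :
    coeff (Finsupp.single s j + e) (mulSigma (X s) F (i :: I)) =
      if i = j then coeff e (F I) else 0 := by
  have h0 : coeff (Finsupp.single s j + e) (F (i :: I)) = 0 :=
    coeff_eq_zero_of_mem_supported (hF _) (k := s) (by simp) (by simp [hj])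
  rw [mulSigma, coeff_add, h0, zero_add]
  unfold posPow
  rcases eq_or_ne i j with rfl | hij
  · rw [if_neg hj, if_pos rfl, X_pow_eq_monomial, coeff_monomial_mul, one_mul]
  · rw [if_neg hij]
    split_ifs with hi
    · simp
    · rw [X_pow_eq_monomial, coeff_monomial_mul']
      split_ifs with h
      · have h1 := h s
        simp [he] at h1
        rw [coeff_eq_zero_of_mem_supported (hF I) (k := s) (by simp), mul_zero]
        simp [he]
        omega
      · rfl

lemma coeff_expo_spread_sigmaProd (s : ℕ) {J : List ℕ} (hJ : ∀ j ∈ J, j ≠ 0) (I : List ℕ) :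
    coeff (expo s (spread J)) (sigmaProd true
      ((List.range' s (2 * J.length)).map (X : ℕ → MvPolynomial ℕ ℂ)) I) =
      if I = J then 1 else 0 := by
  induction J generalizing s I with
  | nil =>
    rw [spread, expo, List.length_nil, mul_zero, List.range'_zero, List.map_nil, sigmaProd]
    split_ifs with h <;> simp [h]
  | cons j J ih =>
    rw [List.forall_mem_cons] at hJ
    rw [spread, expo, expo, Finsupp.single_zero, zero_add, List.length_cons,
      show 2 * (J.length + 1) = 2 * J.length + 1 + 1 by ring, List.range'_succ, List.range'_succ,
      List.map_cons, List.map_cons, sigmaProd, sigmaProd]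
    have hs : expo (s + 1 + 1) (spread J) s = 0 := expo_apply_of_lt _ (by omega)
    have hs' : expo (s + 1 + 1) (spread J) (s + 1) = 0 := expo_apply_of_lt _ (by omega)
    cases I with
    | nil =>
      rw [mulSigma, mulSigmaInv, if_neg (by simp)]
      refine coeff_eq_zero_of_mem_supported (S := {s}ᶜ) (k := s)
        (sigmaProd_mem _ _ (fun x hx => ?_) _) (by simp) (by simp [hJ.1])
      obtain ⟨k, hk, rfl⟩ := List.mem_map.1 hx
      simp at hk ⊢
      omega
    | cons i I =>
      rw [coeff_mulSigma_X hs hJ.1, coeff_mulSigmaInv_X hs', ih _ hJ.2]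
      · grind
      · intro K
        refine sigmaProd_mem (supported ℂ {s}ᶜ) false (xs := X (s + 1) :: _) (fun x hx => ?_) K
        rw [← List.map_cons] at hx
        obtain ⟨k, hk, rfl⟩ := List.mem_map.1 hx
        simp at hk ⊢
        omega

lemma listCoeff_basisSol {J : List ℕ} (hJ : ∀ j ∈ J, j ≠ 0) (I : List ℕ) :
    listCoeff (basisSol I) (spread J) = if I = J then 1 else 0 := by
  rw [listCoeff, basisSol, length_spread]
  exact coeff_expo_spread_sigmaProd 0 hJ I

/-- Solutions of degree `d` are in bijection with functions on compositions of `d`. -/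
noncomputable def compositionCoeff (d : ℕ) : SolHomog d →ₗ[ℂ] (Composition d → ℂ) where
  toFun f J := listCoeff f (spread J.blocks)
  map_add' f g := by funext J; exact coeff_add _ _ _
  map_smul' c f := by funext J; exact coeff_smul _ _ _

lemma compositionCoeff_bijective (d : ℕ) : Function.Bijective (compositionCoeff d) := by
  constructor
  · rw [injective_iff_map_eq_zero]
    intro f hf
    refine Subtype.ext (eq_zero_of_listCoeff_spread_eq_zero f.2 fun J hJ hd => ?_)
    exact congrFun hf ⟨J, fun {i} hi => Nat.pos_of_ne_zero (hJ i hi), hd⟩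
  · intro φ
    have hmem (I : Composition d) : basisSol I.blocks ∈ SolHomog d := by
      simpa only [I.blocks_sum] using basisSol_mem I.blocks
    refine ⟨∑ I : Composition d, φ I • ⟨basisSol I.blocks, hmem I⟩, ?_⟩
    have h (I J : Composition d) : compositionCoeff d ⟨basisSol I.blocks, hmem I⟩ J =
        if I = J then 1 else 0 := by
      simp only [Composition.ext_iff]
      exact listCoeff_basisSol (fun j hj => (J.blocks_pos hj).ne') _
    funext J
    simp only [map_sum, map_smul, Finset.sum_apply, Pi.smul_apply, h]
    simp

instance (d : ℕ) : FiniteDimensional ℂ (SolHomog d) :=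
  (LinearEquiv.ofBijective _ (compositionCoeff_bijective d)).symm.finiteDimensional

lemma finrank_solHomog (d : ℕ) : Module.finrank ℂ (SolHomog d) = 2 ^ (d - 1) := by
  rw [(LinearEquiv.ofBijective _ (compositionCoeff_bijective d)).finrank_eq,
    Module.finrank_fintype_fun_eq_card, composition_card]

/-! ### The alternating sum and multiplication by it -/

/-- The solution `x_1 - x_2 + x_3 - ⋯`. -/
noncomputable def altSum : PolySeq := fun n => ∑ j ∈ Finset.range n, (-1) ^ j * X j

lemma altSum_succ (n : ℕ) : altSum (n + 1) = altSum n + (-1) ^ n * X n :=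
  Finset.sum_range_succ _ _

lemma map_altSum {S F : Type*} [CommRing S] [FunLike F (MvPolynomial ℕ ℂ) S]
    [RingHomClass F (MvPolynomial ℕ ℂ) S] (φ : F) (n : ℕ) :
    φ (altSum n) = ∑ j ∈ Finset.range n, (-1) ^ j * φ (X j) := by
  simp [altSum, map_sum]

lemma altSum_mem : altSum ∈ SolHomog 1 := by
  refine ⟨⟨⟨fun n => ?_, fun n => ?_⟩, fun n j hj => ?_⟩, fun n => ?_⟩
  · refine Subalgebra.sum_mem _ fun k hk => Subalgebra.mul_mem _
      (Subalgebra.pow_mem _ (Subalgebra.neg_mem _ (Subalgebra.one_mem _)) _) ?_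
    exact X_mem_supported.2 (Finset.mem_range.1 hk)
  · rw [altSum_succ, map_add, map_mul, killVar_X_self, mul_zero, add_zero, map_altSum]
    exact Finset.sum_congr rfl fun k hk => by rw [killVar_X_of_ne (Finset.mem_range.1 hk).ne]
  · obtain ⟨m, rfl⟩ := Nat.exists_eq_add_of_le hj
    rw [show j + 2 + m - 2 = j + m by omega]
    induction m with
    | zero =>
      have h : collapse j (altSum j) = skip2 j (altSum j) := by
        rw [map_altSum, map_altSum]
        refine Finset.sum_congr rfl fun k hk => ?_
        rw [Finset.mem_range] at hk
        simp only [collapse, skip2, aeval_X, rename_X, if_pos hk]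
        rw [if_neg (by omega)]
      simp only [add_zero, altSum_succ, map_add, h]
      simp [collapse, pow_succ]
    | succ m ih =>
      rw [← add_assoc, ← add_assoc, altSum_succ, altSum_succ, map_add, map_add, ih (by omega)]
      simp only [collapse, skip2, map_mul, map_pow, map_neg, map_one, aeval_X, rename_X]
      rw [if_neg (by omega), if_neg (by omega), Nat.add_right_comm j 2 m, pow_add _ (j + m) 2]
      simp
  · refine IsHomogeneous.sum _ _ _ fun k _ => ?_
    simpa using ((isHomogeneous_one ℕ ℂ).neg.pow k).mul (isHomogeneous_X ℂ k)

lemma altSum_ne_zero {n : ℕ} (hn : n ≠ 0) : altSum n ≠ 0 := by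
  intro h
  have h1 := congrArg (aeval fun j => if j = 0 then (1 : ℂ) else 0) h
  rw [map_altSum, map_zero, Finset.sum_eq_single 0] at h1
  · simp at h1
  · intro k _ hk
    simp [hk]
  · simp [Nat.pos_of_ne_zero hn]

lemma mul_mem_solHomog {f g : PolySeq} {d e : ℕ} (hf : f ∈ SolHomog d) (hg : g ∈ SolHomog e) :
    (fun n => f n * g n : PolySeq) ∈ SolHomog (d + e) := by
  obtain ⟨⟨⟨hf1, hf2⟩, hf3⟩, hf4⟩ := hf
  obtain ⟨⟨⟨hg1, hg2⟩, hg3⟩, hg4⟩ := hg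
  refine ⟨⟨⟨fun n => Subalgebra.mul_mem _ (hf1 n) (hg1 n), fun n => ?_⟩, fun n j h => ?_⟩,
      fun n => (hf4 n).mul (hg4 n)⟩
  · rw [map_mul, hf2, hg2]
  · rw [map_mul, map_mul, hf3 n j h, hg3 n j h]

/-- Multiplication by the alternating sum. -/
noncomputable def mulAltSum (d : ℕ) : SolHomog d →ₗ[ℂ] SolHomog (d + 1) where
  toFun f := ⟨fun n => f.1 n * altSum n, mul_mem_solHomog f.2 altSum_mem⟩
  map_add' f g := Subtype.ext (funext fun n => add_mul (f.1 n) (g.1 n) (altSum n))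
  map_smul' c f := Subtype.ext (funext fun n => smul_mul_assoc c (f.1 n) (altSum n))

lemma eq_zero_of_isHomogeneous_of_supported_zero {P : MvPolynomial ℕ ℂ} {d : ℕ} (hd : d ≠ 0)
    (hP : P.IsHomogeneous d) (hP' : P ∈ supported ℂ (Set.Iio 0)) : P = 0 := by
  ext e
  rw [coeff_zero]
  by_cases he : e = 0
  · exact hP.coeff_eq_zero (by simpa [he] using hd.symm)
  · obtain ⟨k, hk⟩ := Finsupp.ne_iff.1 he
    exact coeff_eq_zero_of_mem_supported hP' (k := k) (by simp) hk

lemma apply_zero_eq_zero {f : PolySeq} {d : ℕ} (hd : d ≠ 0) (hf : f ∈ SolHomog d) : f 0 = 0 :=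
  eq_zero_of_isHomogeneous_of_supported_zero hd (hf.2 0) (hf.1.1.1 0)

lemma mulAltSum_injective {d : ℕ} (hd : d ≠ 0) : Function.Injective (mulAltSum d) := by
  rw [injective_iff_map_eq_zero]
  intro f hf
  refine Subtype.ext (funext fun n => ?_)
  rcases eq_or_ne n 0 with rfl | hn
  · exact apply_zero_eq_zero hd f.2
  · have h : f.1 n * altSum n = 0 := congrFun (congrArg Subtype.val hf) n
    exact (mul_eq_zero.1 h).resolve_right (altSum_ne_zero hn)

/-! ### Polynomials vanishing on interlacing coordinates -/

lemma sum_neg_one_pow_mul_sub (m : ℕ) :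
    ∑ j ∈ Finset.range (2 * m + 1), (-1 : ℤ) ^ j * ((m : ℤ) - j) = 0 := by
  have h (m : ℕ) (a : ℤ) : ∑ j ∈ Finset.range (2 * m + 1), (-1 : ℤ) ^ j * (a - j) = a - m := by
    induction m with
    | zero => simp
    | succ m ih =>
      rw [show 2 * (m + 1) + 1 = 2 * m + 1 + 1 + 1 by ring, Finset.sum_range_succ,
        Finset.sum_range_succ, ih]
      simp [pow_succ, pow_mul]
      ring
  rw [h, sub_self]

lemma aeval_eq_zero_of_vanishes_on_interlacing {m : ℕ} {P : MvPolynomial ℕ ℂ}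
    (hP : ∀ x : Interlacing, x.1.2 = m → aeval (fun j => ((x.1.1 j : ℤ) : ℂ)) P = 0)
    {v : ℕ → ℤ} (hv : ∑ j ∈ Finset.range (2 * m + 1), (-1 : ℤ) ^ j * v j = 0) :
    aeval (fun j => (v j : ℂ)) P = 0 := by
  set h : Polynomial ℂ :=
    aeval (fun j => Polynomial.C (v j : ℂ) + Polynomial.X * Polynomial.C ((m : ℂ) - j)) P with hh
  have eval_h (t : ℂ) : h.eval t = aeval (fun j => (v j : ℂ) + t * ((m : ℂ) - j)) P := by
    rw [hh, ← Polynomial.coe_aeval_eq_eval, comp_aeval_apply]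
    simp
  obtain ⟨T, hT⟩ : ∃ T : ℕ, ∀ i < 2 * m, v (i + 1) - v i < T := by
    refine ⟨∑ i ∈ Finset.range (2 * m), (v (i + 1) - v i).natAbs + 1, fun i hi => ?_⟩
    have := Finset.single_le_sum (f := fun i => (v (i + 1) - v i).natAbs) (fun _ _ => Nat.zero_le _)
      (Finset.mem_range.2 hi)
    omega
  have root (t : ℕ) (ht : T ≤ t) : h.eval (t : ℂ) = 0 := by
    rw [eval_h]
    have h1 := hP ⟨(fun j => v j + t * ((m : ℤ) - j), m), fun i hi => ?_, ?_⟩ rfl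
    · simpa using h1
    · have h2 := hT i hi
      have h3 : (T : ℤ) ≤ t := by exact_mod_cast ht
      push_cast
      linarith
    · simp only [mul_add, Finset.sum_add_distrib, hv, zero_add, mul_left_comm _ (t : ℤ),
        ← Finset.mul_sum, sum_neg_one_pow_mul_sub, mul_zero]
  have h0 : h = 0 := by
    refine Polynomial.eq_zero_of_infinite_isRoot h (Set.Infinite.mono ?_
      ((Set.Ici_infinite T).image (Nat.cast_injective (R := ℂ)).injOn))
    rintro _ ⟨t, ht, rfl⟩
    exact root t ht
  simpa [h0] using (eval_h 0).symm

lemma altSum_dvd_of_vanishes_on_interlacing {m : ℕ} {P : MvPolynomial ℕ ℂ}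
    (hP : ∀ x : Interlacing, x.1.2 = m → aeval (fun j => ((x.1.1 j : ℤ) : ℂ)) P = 0) :
    altSum (2 * m + 1) ∣ P := by
  set s := altSum (2 * m + 1) with hs
  let φ : MvPolynomial ℕ ℂ →ₐ[ℂ] MvPolynomial ℕ ℂ := aeval fun j => if j = 0 then X 0 - s else X j
  have h1 : φ P = 0 := by
    refine funext_set (fun _ => Set.range fun a : ℤ => (a : ℂ))
      (fun _ => Set.infinite_range_of_injective Int.cast_injective) fun x hx => ?_
    choose v hv using fun j => hx j trivial
    obtain rfl : (fun j => (v j : ℂ)) = x := _root_.funext hv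
    set S := ∑ j ∈ Finset.range (2 * m + 1), (-1 : ℤ) ^ j * v j with hS
    have h2 := aeval_eq_zero_of_vanishes_on_interlacing hP
      (v := fun j => if j = 0 then v 0 - S else v j) (by
        rw [Finset.sum_range_succ'] at hS ⊢
        simp [hS])
    rw [map_zero, ← h2, ← aeval_eq_eval, comp_aeval_apply]
    congr 2
    funext j
    split_ifs
    · rw [map_sub, map_altSum]
      simp [hS]
    · simp
  have h2 : (Ideal.Quotient.mkₐ ℂ (Ideal.span {s})).comp φ = Ideal.Quotient.mkₐ ℂ _ := by
    ext j : 1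
    simp only [AlgHom.comp_apply, φ, aeval_X]
    split_ifs with h
    · subst h
      simp [Ideal.Quotient.mk_singleton_self]
    · rfl
  have h3 := DFunLike.congr_fun h2 P
  rw [AlgHom.comp_apply, h1, map_zero] at h3
  exact Ideal.mem_span_singleton.1 (Ideal.Quotient.eq_zero_iff_mem.1 h3.symm)

/-! ### The kernel of the evaluation map -/

/-- Substitute `0` for all variables of index at least `n`. -/
noncomputable def truncVars (n : ℕ) : MvPolynomial ℕ ℂ →ₐ[ℂ] MvPolynomial ℕ ℂ :=
  aeval fun j => if j ∈ Set.Iio n then X j else 0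

lemma truncVars_eq_self {n : ℕ} {P : MvPolynomial ℕ ℂ} (hP : P ∈ supported ℂ (Set.Iio n)) :
    truncVars n P = P :=
  aeval_ite_mem_eq_self P (mem_supported.1 hP)

lemma aeval_mem_subalgebra {T : Subalgebra ℂ (MvPolynomial ℕ ℂ)} {g : ℕ → MvPolynomial ℕ ℂ}
    (hg : ∀ j, g j ∈ T) (P : MvPolynomial ℕ ℂ) : aeval g P ∈ T := by
  have h := comp_aeval_apply (fun j => (⟨g j, hg j⟩ : T)) T.val P
  exact h ▸ (aeval (fun j => (⟨g j, hg j⟩ : T)) P).2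

lemma truncVars_mem_supported (n : ℕ) (P : MvPolynomial ℕ ℂ) :
    truncVars n P ∈ supported ℂ (Set.Iio n) := by
  refine aeval_mem_subalgebra (fun j => ?_) P
  split_ifs with h
  exacts [X_mem_supported.2 h, Subalgebra.zero_mem _]

lemma truncVars_isHomogeneous (n : ℕ) {d : ℕ} {P : MvPolynomial ℕ ℂ} (hP : P.IsHomogeneous d) :
    (truncVars n P).IsHomogeneous d := by
  have h := hP.aeval (n := 1) (fun j => if j ∈ Set.Iio n then (X j : MvPolynomial ℕ ℂ) else 0)
    fun j => by
      split_ifs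
      exacts [isHomogeneous_X _ _, isHomogeneous_zero _ _ _]
  rwa [one_mul] at h

lemma killVar_isHomogeneous (n : ℕ) {d : ℕ} {P : MvPolynomial ℕ ℂ} (hP : P.IsHomogeneous d) :
    (killVar n P).IsHomogeneous d := by
  have h := hP.aeval (n := 1) (fun j => if j = n then (0 : MvPolynomial ℕ ℂ) else X j)
    fun j => by
      split_ifs
      exacts [isHomogeneous_zero _ _ _, isHomogeneous_X _ _]
  rwa [one_mul] at h

lemma killVar_mem_supported {n : ℕ} {P : MvPolynomial ℕ ℂ}
    (hP : P ∈ supported ℂ (Set.Iio (n + 1))) : killVar n P ∈ supported ℂ (Set.Iio n) := by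
  rw [← truncVars_eq_self hP, truncVars, comp_aeval_apply]
  refine aeval_mem_subalgebra (fun j => ?_) P
  split_ifs with h
  · rw [killVar, aeval_X]
    split_ifs with h'
    · exact Subalgebra.zero_mem _
    · exact X_mem_supported.2 (lt_of_le_of_ne (Nat.lt_succ_iff.1 h) h')
  · simp

lemma homogeneousComponent_mul_of_isHomogeneous {s : MvPolynomial ℕ ℂ} {i : ℕ}
    (hs : s.IsHomogeneous i) (q : MvPolynomial ℕ ℂ) (d : ℕ) :
    homogeneousComponent (i + d) (s * q) = s * homogeneousComponent d q := by
  let _ : GradedRing (homogeneousSubmodule ℕ ℂ) := gradedAlgebra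
  have h := DirectSum.coe_decompose_mul_add_of_left_mem (homogeneousSubmodule ℕ ℂ) (j := d)
    (b := q) ((mem_homogeneousSubmodule i s).2 hs)
  rwa [← decomposition.decompose'_apply, ← decomposition.decompose'_apply]

lemma exists_supported_isHomogeneous_mul_eq {n d : ℕ} {P s : MvPolynomial ℕ ℂ}
    (hP : P ∈ supported ℂ (Set.Iio n)) (hP' : P.IsHomogeneous (d + 1))
    (hs : s ∈ supported ℂ (Set.Iio n)) (hs' : s.IsHomogeneous 1) (h : s ∣ P) :
    ∃ q ∈ supported ℂ (Set.Iio n), q.IsHomogeneous d ∧ P = q * s := by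
  obtain ⟨q, hq⟩ := h
  have h1 : P = s * homogeneousComponent d q := by
    rw [← homogeneousComponent_mul_of_isHomogeneous hs', ← hq, add_comm,
      homogeneousComponent_of_mem hP', if_pos rfl]
  refine ⟨truncVars n (homogeneousComponent d q), truncVars_mem_supported _ _,
    truncVars_isHomogeneous _ (homogeneousComponent_isHomogeneous d q), ?_⟩
  conv_lhs => rw [← truncVars_eq_self hP, h1, map_mul, truncVars_eq_self hs, mul_comm]

lemma collapse_zero_killVar_two (P : MvPolynomial ℕ ℂ) :
    collapse 0 (killVar 2 P) = killVar 2 (collapse 0 P) := by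
  have h : (collapse 0).comp (killVar 2) = (killVar 2).comp (collapse 0) := by
    ext j : 1
    rcases j with _ | _ | _ | j <;> simp [collapse, killVar]
  exact DFunLike.congr_fun h P

lemma killVar_two_skip2_zero (P : MvPolynomial ℕ ℂ) :
    killVar 2 (skip2 0 P) = skip2 0 (killVar 0 P) := by
  have h : (killVar 2).comp (skip2 0) = (skip2 0).comp (killVar 0) := by
    ext j : 1
    rcases j with _ | j <;> simp [skip2, killVar]
  exact DFunLike.congr_fun h P

lemma exists_mul_altSum_eq {f : PolySeq} {d : ℕ} (hf : f ∈ SolHomog (d + 1))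
    (h0 : ActY f = 0) (n : ℕ) :
    ∃ q ∈ supported ℂ (Set.Iio n), q.IsHomogeneous d ∧ f n = q * altSum n := by
  have hodd (m : ℕ) : ∃ q ∈ supported ℂ (Set.Iio (2 * m + 1)), q.IsHomogeneous d ∧
      f (2 * m + 1) = q * altSum (2 * m + 1) := by
    refine exists_supported_isHomogeneous_mul_eq (hf.1.1.1 _) (hf.2 _) (altSum_mem.1.1.1 _)
      (altSum_mem.2 _) (altSum_dvd_of_vanishes_on_interlacing ?_)
    rintro x rfl
    exact congrFun h0 x
  obtain ⟨m, rfl | rfl⟩ := Nat.even_or_odd' n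
  · obtain ⟨q, hq, hq', h⟩ := hodd m
    refine ⟨killVar (2 * m) q, killVar_mem_supported hq, killVar_isHomogeneous _ hq', ?_⟩
    rw [← hf.1.1.2, ← altSum_mem.1.1.2, h, map_mul]
  · exact hodd m

lemma exists_mulAltSum_eq {f : PolySeq} {d : ℕ} (hd : d ≠ 0) (hf : f ∈ SolHomog (d + 1))
    (h0 : ActY f = 0) : ∃ g ∈ SolHomog d, ∀ n, f n = g n * altSum n := by
  choose g hg hg' hfg using exists_mul_altSum_eq hf h0
  have g0 : g 0 = 0 := eq_zero_of_isHomogeneous_of_supported_zero hd (hg' 0) (hg 0)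
  have stable (n : ℕ) : killVar n (g (n + 1)) = g n := by
    rcases eq_or_ne n 0 with rfl | hn
    · rw [g0]
      exact eq_zero_of_isHomogeneous_of_supported_zero hd (killVar_isHomogeneous _ (hg' 1))
        (killVar_mem_supported (hg 1))
    · apply mul_right_cancel₀ (altSum_ne_zero hn)
      rw [← hfg, ← hf.1.1.2, hfg, map_mul, altSum_mem.1.1.2]
  have collapse_of_ne (n j : ℕ) (hj : j + 2 ≤ n) (hn : n - 2 ≠ 0) :
      collapse j (g n) = skip2 j (g (n - 2)) := by
    have h1 : skip2 j (altSum (n - 2)) ≠ 0 := by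
      rw [skip2, Ne, map_eq_zero_iff _ (rename_injective _ (skip_injective j))]
      exact altSum_ne_zero hn
    apply mul_right_cancel₀ h1
    rw [← map_mul, ← hfg, ← hf.1.2 n j hj, hfg, map_mul, altSum_mem.1.2 n j hj]
  refine ⟨g, ⟨⟨⟨hg, stable⟩, fun n j hj => ?_⟩, hg'⟩, hfg⟩
  by_cases hn : n - 2 = 0
  · obtain ⟨rfl, rfl⟩ : n = 2 ∧ j = 0 := by omega
    rw [← stable 2, collapse_zero_killVar_two, collapse_of_ne 3 0 (by omega) (by omega),
      killVar_two_skip2_zero, stable]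
  · exact collapse_of_ne n j hj hn

lemma actY_mul_altSum (f : PolySeq) : ActY (fun n => f n * altSum n) = 0 := by
  funext x
  have h : aeval (fun j => ((x.1.1 j : ℤ) : ℂ)) (altSum (2 * x.1.2 + 1)) = 0 := by
    rw [map_altSum]
    simp only [aeval_X]
    exact_mod_cast x.2.2
  change aeval _ (f _ * altSum _) = 0
  rw [map_mul, h, mul_zero]

lemma range_mulAltSum {d : ℕ} (hd : d ≠ 0) :
    LinearMap.range (mulAltSum d) = LinearMap.ker (ActY.domRestrict (SolHomog (d + 1))) := by
  ext f
  rw [LinearMap.mem_range, LinearMap.mem_ker, LinearMap.domRestrict_apply]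
  constructor
  · rintro ⟨g, rfl⟩
    exact actY_mul_altSum g.1
  · intro h
    obtain ⟨g, hg, hfg⟩ := exists_mulAltSum_eq hd f.2 h
    exact ⟨⟨g, hg⟩, Subtype.ext (funext fun n => (hfg n).symm)⟩

/-- For `n ≥ 2`, the space of functions on Young diagrams obtained by
restricting homogeneous degree-`n` solutions of the functional equation to lists of
interlacing coordinates has dimension `2 ^ (n-2)`. -/
theorem image_actY_dimension (n : ℕ) (hn : 2 ≤ n) :
    Module.finrank ℂ ((SolHomog n).map ActY) = 2 ^ (n - 2) := by
  obtain ⟨d, rfl⟩ : ∃ d, n = d + 2 := ⟨n - 2, by omega⟩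
  have h := LinearMap.finrank_range_add_finrank_ker (ActY.domRestrict (SolHomog (d + 1 + 1)))
  rw [← range_mulAltSum d.succ_ne_zero,
    LinearMap.finrank_range_of_inj (mulAltSum_injective d.succ_ne_zero),
    LinearMap.range_domRestrict, finrank_solHomog, finrank_solHomog, Nat.add_sub_cancel,
    Nat.succ_sub_one, pow_succ] at h
  change Module.finrank ℂ ((SolHomog (d + 2)).map ActY) + 2 ^ d = 2 ^ d * 2 at h
  rw [Nat.add_sub_cancel]
  omega
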